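/- arXiv:1208.3187 — 3 statements merged into one kernel-verified Lean document; each statement's English description precedes it below -/
import Mathlib

section
/- In the iidpnmrv setup with E^*[|X₁|] < ∞, almost surely (i.e., on a P-measurable set of P-measure 1) one has E_*[X₁] ≤ liminf_{n→∞} Sₙ/n ≤ limsup_{n→∞} Sₙ/n ≤ E^*[X₁]. -/
open MeasureTheory Filter Topology

/-- `flow` is a maximal measurable minorant of `f` with respect to the measure `P`. -/
def IsMeasMinorant {Ω : Type*} [MeasurableSpace Ω] (P : Measure Ω) (f flow : Ω → ℝ) : Prop :=
  Measurable flow ∧ (∀ ω, flow ω ≤ f ω) ∧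
    ∀ g : Ω → ℝ, Measurable g → (∀ ω, g ω ≤ f ω) → ∀ᵐ ω ∂P, g ω ≤ flow ω

/-- `fup` is a minimal measurable majorant of `f` with respect to the measure `P`. -/
def IsMeasMajorant {Ω : Type*} [MeasurableSpace Ω] (P : Measure Ω) (f fup : Ω → ℝ) : Prop :=
  Measurable fup ∧ (∀ ω, f ω ≤ fup ω) ∧
    ∀ h : Ω → ℝ, Measurable h → (∀ ω, f ω ≤ h ω) → ∀ᵐ ω ∂P, fup ω ≤ h ω

theorem ae_tendsto_average_infinitePi {Ω₁ : Type*} [MeasurableSpace Ω₁] (P₁ : Measure Ω₁)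
    [IsProbabilityMeasure P₁] {f : Ω₁ → ℝ} (hf : Measurable f) (hint : Integrable f P₁) :
    ∀ᵐ ω ∂(Measure.infinitePi fun _ : ℕ => P₁),
      Tendsto (fun n : ℕ => (∑ i ∈ Finset.range n, f (ω i)) / n) atTop (𝓝 (∫ x, f x ∂P₁)) := by
  have hp (i : ℕ) : MeasurePreserving (Function.eval i) (Measure.infinitePi fun _ : ℕ => P₁) P₁ :=
    measurePreserving_eval_infinitePi (fun _ : ℕ => P₁) i
  have hindep : ProbabilityTheory.iIndepFun (fun (i : ℕ) (ω : ℕ → Ω₁) => f (ω i))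
      (Measure.infinitePi fun _ : ℕ => P₁) :=
    ProbabilityTheory.iIndepFun_infinitePi (X := fun _ => f) fun _ => hf
  have hmap (i : ℕ) : (Measure.infinitePi fun _ : ℕ => P₁).map (fun ω => f (ω i)) = P₁.map f := by
    conv_rhs => rw [← (hp i).map_eq, Measure.map_map hf (hp i).measurable]
    rfl
  have h := ProbabilityTheory.strong_law_ae_real
    (μ := Measure.infinitePi fun _ : ℕ => P₁) (fun (i : ℕ) (ω : ℕ → Ω₁) => f (ω i))
    ((hp 0).integrable_comp_of_integrable hint) (fun i j hij => hindep.indepFun hij)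
    fun i => ⟨(hf.comp (measurable_pi_apply i)).aemeasurable,
      (hf.comp (measurable_pi_apply 0)).aemeasurable, by rw [hmap, hmap]⟩
  have hexp : ∫ ω : ℕ → Ω₁, f (ω 0) ∂(Measure.infinitePi fun _ : ℕ => P₁) = ∫ x, f x ∂P₁ := by
    conv_rhs =>
      rw [← (hp 0).map_eq, integral_map (hp 0).measurable.aemeasurable hf.aestronglyMeasurable]
  rwa [hexp] at h

/-- **Easy LLN bounds for nonmeasurable iid random variables.** In the iidpnmrv setup
(`P` is the countable product of copies of the probability space `(Ω₁, F₁, P₁)`,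
`Xₙ ω = Ψ (ω n)`, `Sₙ = X₁ + ⋯ + Xₙ`), if a minimal measurable majorant of `|Ψ|` is
integrable, then on a measurable set of `P`-measure one,
`E_*[X₁] ≤ liminf Sₙ/n ≤ limsup Sₙ/n ≤ E^*[X₁]`. -/
theorem lln_bounds_iidpnmrv
    {Ω₁ : Type*} [MeasurableSpace Ω₁] (P₁ : Measure Ω₁) [IsProbabilityMeasure P₁]
    (P : Measure (ℕ → Ω₁)) [IsProbabilityMeasure P]
    (hP : IsProjectiveLimit P (fun J : Finset ℕ => Measure.pi (fun _ : J => P₁)))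
    (Ψ Ψlow Ψup Ψabs : Ω₁ → ℝ)
    (hΨlow : IsMeasMinorant P₁ Ψ Ψlow)
    (hΨup : IsMeasMajorant P₁ Ψ Ψup)
    (hΨabs : IsMeasMajorant P₁ (fun x => |Ψ x|) Ψabs)
    (hInt : Integrable Ψabs P₁) :
    ∃ G : Set (ℕ → Ω₁), MeasurableSet G ∧ P G = 1 ∧
      ∀ ω ∈ G,
        (∫ x, Ψlow x ∂P₁) ≤
            atTop.liminf (fun n : ℕ => (∑ i ∈ Finset.range n, Ψ (ω i)) / n) ∧
        atTop.liminf (fun n : ℕ => (∑ i ∈ Finset.range n, Ψ (ω i)) / n) ≤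
            atTop.limsup (fun n : ℕ => (∑ i ∈ Finset.range n, Ψ (ω i)) / n) ∧
        atTop.limsup (fun n : ℕ => (∑ i ∈ Finset.range n, Ψ (ω i)) / n) ≤
            ∫ x, Ψup x ∂P₁ := by
  obtain ⟨hlow_meas, hlow_le, hlow_max⟩ := hΨlow
  obtain ⟨hup_meas, hup_le, hup_min⟩ := hΨup
  obtain ⟨habs_meas, habs_le, -⟩ := hΨabs
  have hlow_int : Integrable Ψlow P₁ := by
    refine hInt.mono' hlow_meas.aestronglyMeasurable ?_
    filter_upwards [hlow_max (fun x => -Ψabs x) habs_meas.neg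
      fun x => (neg_le_neg (habs_le x)).trans (neg_abs_le _)] with x hx
    exact abs_le.2 ⟨hx, (hlow_le x).trans ((le_abs_self _).trans (habs_le x))⟩
  have hup_int : Integrable Ψup P₁ := by
    refine hInt.mono' hup_meas.aestronglyMeasurable ?_
    filter_upwards [hup_min Ψabs habs_meas fun x => (le_abs_self _).trans (habs_le x)] with x hx
    exact abs_le.2
      ⟨((neg_le_neg (habs_le x)).trans (neg_abs_le _)).trans (hup_le x), hx⟩
  obtain rfl : P = Measure.infinitePi fun _ : ℕ => P₁ :=
    hP.unique (Measure.isProjectiveLimit_infinitePi fun _ : ℕ => P₁)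
  have hae := (ae_tendsto_average_infinitePi P₁ hlow_meas hlow_int).and
    (ae_tendsto_average_infinitePi P₁ hup_meas hup_int)
  obtain ⟨G, hG_sub, hG_meas, hG_null⟩ := exists_measurable_superset_of_null (ae_iff.1 hae)
  refine ⟨Gᶜ, hG_meas.compl, (prob_compl_eq_one_iff hG_meas).2 hG_null, fun ω hω => ?_⟩
  obtain ⟨hlow_lim, hup_lim⟩ := not_not.1 fun h => hω (hG_sub h)
  have hle_low (n : ℕ) : (∑ i ∈ Finset.range n, Ψlow (ω i)) / n ≤
      (∑ i ∈ Finset.range n, Ψ (ω i)) / n := by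
    gcongr
    exact hlow_le _
  have hle_up (n : ℕ) : (∑ i ∈ Finset.range n, Ψ (ω i)) / n ≤
      (∑ i ∈ Finset.range n, Ψup (ω i)) / n := by
    gcongr
    exact hup_le _
  have hbdd_below : IsBoundedUnder (· ≥ ·) atTop
      fun n : ℕ => (∑ i ∈ Finset.range n, Ψ (ω i)) / n :=
    hlow_lim.isBoundedUnder_ge.mono_ge (.of_forall hle_low)
  have hbdd_above : IsBoundedUnder (· ≤ ·) atTop
      fun n : ℕ => (∑ i ∈ Finset.range n, Ψ (ω i)) / n :=
    hup_lim.isBoundedUnder_le.mono_le (.of_forall hle_up)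
  refine ⟨?_, liminf_le_limsup hbdd_above hbdd_below, ?_⟩
  · rw [← hlow_lim.liminf_eq]
    exact liminf_le_liminf (.of_forall hle_low) hlow_lim.isBoundedUnder_ge
      hbdd_above.isCoboundedUnder_ge
  · rw [← hup_lim.limsup_eq]
    exact limsup_le_limsup (.of_forall hle_up) hbdd_below.isCoboundedUnder_le
      hup_lim.isBoundedUnder_le
end

section
/- In the iidpnmrv setup with E^*[|X₁|] < ∞, let A be a non-empty proper subset of the interval [E_*[X₁], E^*[X₁]]. Then the set {ω ∈ Ω : liminf_{n→∞} Sₙ(ω)/n ∈ A} is maximally nonmeasurable: every P-measurable subset of it has P-measure 0 and every P-measurable superset of it has P-measure 1. -/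
open MeasureTheory Filter Topology

/-- A set of full outer measure carries a trace of the measure on its subtype. -/
lemma exists_measure_map_subtype_val_eq {E : Type*} [MeasurableSpace E] (Q : Measure E)
    [IsProbabilityMeasure Q] {D : Set E} (hD : Q D = 1) :
    ∃ ν : Measure D, ν.map Subtype.val = Q := by
  have hle : (inferInstance : MeasurableSpace D) ≤
      (OuterMeasure.comap (Subtype.val : D → E) Q.toOuterMeasure).caratheodory := by
    rintro s ⟨M, hM, rfl⟩ t
    simp only [OuterMeasure.comap_apply]
    rw [Set.image_inter_preimage, Set.image_sdiff_preimage]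
    exact le_toOuterMeasure_caratheodory Q _ hM _
  refine ⟨(OuterMeasure.comap (Subtype.val : D → E) Q.toOuterMeasure).toMeasure hle, ?_⟩
  ext M hM
  rw [Measure.map_apply measurable_subtype_coe hM,
    toMeasure_apply _ _ (measurable_subtype_coe hM), OuterMeasure.comap_apply,
    Subtype.image_preimage_coe]
  change Q (D ∩ M) = Q M
  rw [← Measure.measure_toMeasurable_inter hM (measure_ne_top Q D)]
  refine Measure.measure_inter_eq_of_ae ?_
  exact (mem_ae_iff_prob_eq_one (measurableSet_toMeasurable Q D)).2
    ((measure_toMeasurable D).trans hD)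

/-- A product of sets of full outer measure has full outer measure. -/
lemma infinitePi_univ_pi_eq_one {ι : Type*} {E : ι → Type*} [∀ i, MeasurableSpace (E i)]
    (Q : ∀ i, Measure (E i)) [∀ i, IsProbabilityMeasure (Q i)] {D : ∀ i, Set (E i)}
    (hD : ∀ i, Q i (D i) = 1) :
    Measure.infinitePi Q (Set.univ.pi D) = 1 := by
  choose ν hν using fun i => exists_measure_map_subtype_val_eq (Q i) (hD i)
  have hprob (i : ι) : IsProbabilityMeasure (ν i) := by
    constructor
    rw [← Set.preimage_univ (f := (Subtype.val : D i → E i)),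
      ← Measure.map_apply measurable_subtype_coe .univ, hν, measure_univ]
  have hmap : (Measure.infinitePi ν).map (fun x i => (x i : E i)) = Measure.infinitePi Q := by
    rw [Measure.infinitePi_map_pi (f := fun i => (Subtype.val : D i → E i)) ν
      fun i => measurable_subtype_coe]
    simp only [hν]
  rw [← measure_toMeasurable, ← hmap, Measure.map_apply (by fun_prop) (measurableSet_toMeasurable _ _),
    hmap, Set.preimage_eq_univ_iff.2, measure_univ]
  rintro _ ⟨x, rfl⟩
  exact subset_toMeasurable _ _ fun i _ => (x i).2

lemma inter_nonempty_of_measure_eq_one {E : Type*} [MeasurableSpace E] {Q : Measure E}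
    [IsProbabilityMeasure Q] {S B : Set E} (hS : Q S = 1) (hB : MeasurableSet B) (hB' : Q B ≠ 0) :
    (S ∩ B).Nonempty := by
  by_contra h
  rw [Set.not_nonempty_iff_eq_empty, ← Set.disjoint_iff_inter_eq_empty,
    ← Set.subset_compl_iff_disjoint_right] at h
  have h1 : Q Bᶜ = 1 := le_antisymm prob_le_one (hS ▸ measure_mono h)
  exact hB' ((prob_compl_eq_one_iff hB).1 h1)

lemma IsMeasMinorant.measure_lt_add_eq_one {Ω : Type*} [MeasurableSpace Ω] {P : Measure Ω}
    [IsProbabilityMeasure P] {f flow : Ω → ℝ} (h : IsMeasMinorant P f flow) {ε : ℝ} (hε : 0 < ε) :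
    P {x | f x < flow x + ε} = 1 := by
  classical
  set T := toMeasurable P {x | f x < flow x + ε} with hT
  have hTm : MeasurableSet T := measurableSet_toMeasurable _ _
  have hae := h.2.2 (T.piecewise flow fun x => flow x + ε)
    (h.1.piecewise hTm (h.1.add_const ε)) fun x => by
      by_cases hx : x ∈ T
      · simpa [hx] using h.2.1 x
      · have : x ∉ {x | f x < flow x + ε} := fun h' => hx (subset_toMeasurable _ _ h')
        simpa [hx] using this
  rw [← measure_toMeasurable, ← hT, ← mem_ae_iff_prob_eq_one hTm]
  filter_upwards [hae] with x hx
  by_contra hxT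
  simp only [hxT, not_false_eq_true, Set.piecewise_eq_of_notMem] at hx
  linarith

lemma IsMeasMajorant.neg {Ω : Type*} [MeasurableSpace Ω] {P : Measure Ω}
    {f fup : Ω → ℝ} (h : IsMeasMajorant P f fup) : IsMeasMinorant P (-f) (-fup) := by
  refine ⟨h.1.neg, fun x => neg_le_neg (h.2.1 x), fun g hg hgf => ?_⟩
  filter_upwards [h.2.2 (-g) hg.neg fun x => le_neg_of_le_neg (hgf x)] with x hx
  exact le_neg_of_le_neg hx

lemma IsMeasMajorant.measure_sub_lt_eq_one {Ω : Type*} [MeasurableSpace Ω] {P : Measure Ω}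
    [IsProbabilityMeasure P] {f fup : Ω → ℝ} (h : IsMeasMajorant P f fup) {ε : ℝ} (hε : 0 < ε) :
    P {x | fup x - ε < f x} = 1 := by
  rw [← h.neg.measure_lt_add_eq_one hε]
  congr 1
  ext x
  simp only [Set.mem_ofPred_eq, Pi.neg_apply]
  constructor <;> intro h <;> linarith

lemma IsMeasMinorant.integrable {Ω : Type*} [MeasurableSpace Ω] {P : Measure Ω}
    {f flow fabs : Ω → ℝ} (h : IsMeasMinorant P f flow)
    (habs : IsMeasMajorant P (fun x => |f x|) fabs) (hint : Integrable fabs P) :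
    Integrable flow P := by
  refine hint.mono' h.1.aestronglyMeasurable ?_
  filter_upwards [h.2.2 (-fabs) habs.1.neg fun x => neg_le_of_abs_le (habs.2.1 x)] with x hx
  exact abs_le.2 ⟨hx, (h.2.1 x).trans ((le_abs_self _).trans (habs.2.1 x))⟩

lemma IsMeasMajorant.integrable {Ω : Type*} [MeasurableSpace Ω] {P : Measure Ω}
    {f fup fabs : Ω → ℝ} (h : IsMeasMajorant P f fup)
    (habs : IsMeasMajorant P (fun x => |f x|) fabs) (hint : Integrable fabs P) :
    Integrable fup P := by
  simpa using (h.neg.integrable (by simpa using habs) hint).neg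

/-- The strong law of large numbers for the coordinates of an infinite product. -/
lemma infinitePi_strong_law {E : Type*} [MeasurableSpace E] (Q : Measure E)
    [IsProbabilityMeasure Q] {Y : E → ℝ} (hY : Measurable Y) (hint : Integrable Y Q) :
    ∀ᵐ e ∂Measure.infinitePi (fun _ : ℕ => Q),
      Tendsto (fun n : ℕ => (∑ i ∈ Finset.range n, Y (e i)) / n) atTop (𝓝 (∫ x, Y x ∂Q)) := by
  have hmp (i : ℕ) := measurePreserving_eval_infinitePi (fun _ : ℕ => Q) i
  have hlaw := ProbabilityTheory.strong_law_ae_real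
    (μ := Measure.infinitePi (fun _ : ℕ => Q)) (fun i e => Y (e i))
    ((hmp 0).integrable_comp_of_integrable hint)
    (fun i j hij => (ProbabilityTheory.iIndepFun_infinitePi
      (P := fun _ : ℕ => Q) (X := fun _ => Y) fun _ => hY).indepFun hij)
    (fun i => ⟨(hY.comp (measurable_pi_apply i)).aemeasurable,
      (hY.comp (measurable_pi_apply 0)).aemeasurable, by
      rw [← Function.comp_def Y, ← Function.comp_def Y,
        ← Measure.map_map hY (measurable_pi_apply i), ← Measure.map_map hY (measurable_pi_apply 0),
        Measure.infinitePi_map_eval, Measure.infinitePi_map_eval]⟩)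
  have hmean : ∫ e, Y (e 0) ∂Measure.infinitePi (fun _ : ℕ => Q) = ∫ x, Y x ∂Q := by
    conv_rhs => rw [← (hmp 0).map_eq]
    exact (integral_map (hmp 0).aemeasurable hY.aestronglyMeasurable).symm
  rwa [hmean] at hlaw

/-- If `u` is at distance less than `1 / (n + 1)` from `v` then it has the same limit of averages. -/
lemma tendsto_average_of_abs_sub_lt {u v : ℕ → ℝ} {c : ℝ}
    (huv : ∀ n : ℕ, |u n - v n| < 1 / ((n : ℝ) + 1))
    (hv : Tendsto (fun n : ℕ => (∑ i ∈ Finset.range n, v i) / n) atTop (𝓝 c)) :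
    Tendsto (fun n : ℕ => (∑ i ∈ Finset.range n, u i) / n) atTop (𝓝 c) := by
  have h0 : Tendsto (fun n => u n - v n) atTop (𝓝 0) :=
    squeeze_zero_norm (fun n => (huv n).le) tendsto_one_div_add_atTop_nhds_zero_nat
  have := hv.add h0.cesaro
  rw [add_zero] at this
  refine this.congr fun n => ?_
  rw [Finset.sum_sub_distrib]
  ring

/-- The mixture of two copies of `P`, with weights `a` and `b`, on `Ω × Bool`. -/
noncomputable def mixtureMeasure {Ω : Type*} [MeasurableSpace Ω] (P : Measure Ω) (a b : ℝ) :
    Measure (Ω × Bool) :=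
  ENNReal.ofReal a • P.map (fun x => (x, false)) + ENNReal.ofReal b • P.map (fun x => (x, true))

section Mixture

variable {Ω : Type*} [MeasurableSpace Ω] (P : Measure Ω) {a b : ℝ}

lemma mixtureMeasure_apply {T : Set (Ω × Bool)} (hT : MeasurableSet T) :
    mixtureMeasure P a b T = ENNReal.ofReal a * P ((fun x => (x, false)) ⁻¹' T) +
      ENNReal.ofReal b * P ((fun x => (x, true)) ⁻¹' T) := by
  simp only [mixtureMeasure, Measure.add_apply, Measure.smul_apply, smul_eq_mul]
  rw [Measure.map_apply (by fun_prop) hT, Measure.map_apply (by fun_prop) hT]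

lemma map_fst_mixtureMeasure (ha : 0 ≤ a) (hb : 0 ≤ b) (hab : a + b = 1) :
    (mixtureMeasure P a b).map Prod.fst = P := by
  ext s hs
  rw [Measure.map_apply measurable_fst hs, mixtureMeasure_apply P (measurable_fst hs)]
  change ENNReal.ofReal a * P s + ENNReal.ofReal b * P s = P s
  rw [← add_mul, ← ENNReal.ofReal_add ha hb, hab, ENNReal.ofReal_one, one_mul]

lemma isProbabilityMeasure_mixtureMeasure [IsProbabilityMeasure P] (ha : 0 ≤ a) (hb : 0 ≤ b)
    (hab : a + b = 1) : IsProbabilityMeasure (mixtureMeasure P a b) := by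
  constructor
  rw [← Set.preimage_univ (f := (Prod.fst : Ω × Bool → Ω)),
    ← Measure.map_apply measurable_fst .univ, map_fst_mixtureMeasure P ha hb hab, measure_univ]

lemma mixtureMeasure_eq_one [IsProbabilityMeasure P] (ha : 0 ≤ a) (hb : 0 ≤ b) (hab : a + b = 1)
    {D : Set (Ω × Bool)} (hD₀ : P ((fun x => (x, false)) ⁻¹' D) = 1)
    (hD₁ : P ((fun x => (x, true)) ⁻¹' D) = 1) : mixtureMeasure P a b D = 1 := by
  have hsub := subset_toMeasurable (mixtureMeasure P a b) D
  rw [← measure_toMeasurable, mixtureMeasure_apply P (measurableSet_toMeasurable _ _),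
    le_antisymm prob_le_one (hD₀ ▸ measure_mono (Set.preimage_mono hsub)),
    le_antisymm prob_le_one (hD₁ ▸ measure_mono (Set.preimage_mono hsub)),
    mul_one, mul_one, ← ENNReal.ofReal_add ha hb, hab, ENNReal.ofReal_one]

variable {P} {f g : Ω → ℝ}

lemma measurable_cond_prod (hf : Measurable f) (hg : Measurable g) :
    Measurable fun e : Ω × Bool => cond e.2 (g e.1) (f e.1) :=
  measurable_from_prod_countable_left fun t => by cases t <;> assumption

lemma integrable_cond_mixtureMeasure (hf : Measurable f) (hg : Measurable g)
    (hfi : Integrable f P) (hgi : Integrable g P) :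
    Integrable (fun e : Ω × Bool => cond e.2 (g e.1) (f e.1)) (mixtureMeasure P a b) := by
  have hm := measurable_cond_prod hf hg
  refine .add_measure (.smul_measure ?_ ENNReal.ofReal_ne_top)
    (.smul_measure ?_ ENNReal.ofReal_ne_top)
  · exact (integrable_map_measure hm.aestronglyMeasurable (by fun_prop)).2 hfi
  · exact (integrable_map_measure hm.aestronglyMeasurable (by fun_prop)).2 hgi

lemma integral_cond_mixtureMeasure (ha : 0 ≤ a) (hb : 0 ≤ b) (hf : Measurable f)
    (hg : Measurable g) (hfi : Integrable f P) (hgi : Integrable g P) :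
    ∫ e, cond e.2 (g e.1) (f e.1) ∂mixtureMeasure P a b = a * ∫ x, f x ∂P + b * ∫ x, g x ∂P := by
  have hm := measurable_cond_prod hf hg
  have hf' : Integrable (fun e : Ω × Bool => cond e.2 (g e.1) (f e.1))
      (P.map fun x => (x, false)) :=
    (integrable_map_measure hm.aestronglyMeasurable (by fun_prop)).2 hfi
  have hg' : Integrable (fun e : Ω × Bool => cond e.2 (g e.1) (f e.1))
      (P.map fun x => (x, true)) :=
    (integrable_map_measure hm.aestronglyMeasurable (by fun_prop)).2 hgi
  rw [mixtureMeasure, integral_add_measure (hf'.smul_measure ENNReal.ofReal_ne_top)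
    (hg'.smul_measure ENNReal.ofReal_ne_top), integral_smul_measure, integral_smul_measure,
    integral_map (by fun_prop) hm.aestronglyMeasurable,
    integral_map (by fun_prop) hm.aestronglyMeasurable, ENNReal.toReal_ofReal ha,
    ENNReal.toReal_ofReal hb]
  rfl

end Mixture

/-- Every event of positive probability contains a point at which the averages converge to a
prescribed value between the lower and the upper expectation. -/
lemma exists_mem_tendsto_average {Ω : Type*} [MeasurableSpace Ω] {P : Measure Ω}
    [IsProbabilityMeasure P] {f flow fup fabs : Ω → ℝ} (hlow : IsMeasMinorant P f flow)
    (hup : IsMeasMajorant P f fup) (habs : IsMeasMajorant P (fun x => |f x|) fabs)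
    (hint : Integrable fabs P) {c : ℝ} (hc : c ∈ Set.Icc (∫ x, flow x ∂P) (∫ x, fup x ∂P))
    {B : Set (ℕ → Ω)} (hB : MeasurableSet B)
    (hB' : Measure.infinitePi (fun _ : ℕ => P) B ≠ 0) :
    ∃ ω ∈ B, Tendsto (fun n : ℕ => (∑ i ∈ Finset.range n, f (ω i)) / n) atTop (𝓝 c) := by
  rw [← segment_eq_Icc (hc.1.trans hc.2)] at hc
  obtain ⟨a, b, ha, hb, hab, rfl⟩ := hc
  have hprob := isProbabilityMeasure_mixtureMeasure P ha hb hab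
  set Y : Ω × Bool → ℝ := fun e => cond e.2 (fup e.1) (flow e.1) with hYdef
  have hilow := hlow.integrable habs hint
  have hiup := hup.integrable habs hint
  have hlaw := infinitePi_strong_law (mixtureMeasure P a b) (measurable_cond_prod hlow.1 hup.1)
    (integrable_cond_mixtureMeasure hlow.1 hup.1 hilow hiup)
  rw [integral_cond_mixtureMeasure ha hb hlow.1 hup.1 hilow hiup] at hlaw
  obtain ⟨G, hGsub, hGm, hG⟩ := exists_measurable_superset_of_null (ae_iff.1 hlaw)
  set π : (ℕ → Ω × Bool) → ℕ → Ω := fun e i => (e i).1 with hπ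
  have hπm : Measurable π := by fun_prop
  have hπB : Measure.infinitePi (fun _ : ℕ => mixtureMeasure P a b) (π ⁻¹' B) ≠ 0 := by
    rw [← Measure.map_apply hπm hB, hπ,
      Measure.infinitePi_map_pi (fun _ : ℕ => mixtureMeasure P a b) fun _ => measurable_fst]
    simpa only [map_fst_mixtureMeasure P ha hb hab] using hB'
  have hD (n : ℕ) : mixtureMeasure P a b {e | |f e.1 - Y e| < 1 / ((n : ℝ) + 1)} = 1 := by
    have hn : (0 : ℝ) < 1 / ((n : ℝ) + 1) := Nat.one_div_pos_of_nat
    refine mixtureMeasure_eq_one P ha hb hab ?_ ?_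
    · rw [← hlow.measure_lt_add_eq_one hn]
      congr 1
      ext x
      have := hlow.2.1 x
      simp only [hYdef, Set.mem_preimage, Set.mem_ofPred_eq, cond_false]
      rw [abs_of_nonneg (by linarith), sub_lt_iff_lt_add']
    · rw [← hup.measure_sub_lt_eq_one hn]
      congr 1
      ext x
      have := hup.2.1 x
      simp only [hYdef, Set.mem_preimage, Set.mem_ofPred_eq, cond_true]
      rw [abs_of_nonpos (by linarith), neg_sub, sub_lt_comm]
  obtain ⟨e, heD, heB, heG⟩ := inter_nonempty_of_measure_eq_one
    (infinitePi_univ_pi_eq_one (fun _ : ℕ => mixtureMeasure P a b) hD)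
    ((hπm hB).diff hGm) (by rwa [measure_sdiff_null hG])
  refine ⟨π e, heB, tendsto_average_of_abs_sub_lt (v := fun i => Y (e i))
    (fun n => heD n (Set.mem_univ n)) ?_⟩
  by_contra hne
  exact heG (hGsub hne)

/-- In the iidpnmrv setup with integrable minimal measurable majorant of `|Ψ|`, for any nonempty proper subset `A` of `[E_*[X₁], E^*[X₁]]`, the set where `liminf Sₙ/n ∈ A` is maximally nonmeasurable. -/
theorem liminf_mem_maximally_nonmeasurable
    {Ω₁ : Type*} [MeasurableSpace Ω₁] (P₁ : Measure Ω₁) [IsProbabilityMeasure P₁]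
    (P : Measure (ℕ → Ω₁)) [IsProbabilityMeasure P]
    (hP : IsProjectiveLimit P (fun J : Finset ℕ => Measure.pi (fun _ : J => P₁)))
    (Ψ Ψlow Ψup Ψabs : Ω₁ → ℝ)
    (hΨlow : IsMeasMinorant P₁ Ψ Ψlow)
    (hΨup : IsMeasMajorant P₁ Ψ Ψup)
    (hΨabs : IsMeasMajorant P₁ (fun x => |Ψ x|) Ψabs)
    (hInt : Integrable Ψabs P₁)
    (A : Set ℝ) (hA₁ : A.Nonempty)
    (hA₂ : A ⊆ Set.Icc (∫ x, Ψlow x ∂P₁) (∫ x, Ψup x ∂P₁))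
    (hA₃ : A ≠ Set.Icc (∫ x, Ψlow x ∂P₁) (∫ x, Ψup x ∂P₁)) :
    (∀ B : Set (ℕ → Ω₁), MeasurableSet B →
        B ⊆ {ω : ℕ → Ω₁ | atTop.liminf (fun n : ℕ => (∑ i ∈ Finset.range n, Ψ (ω i)) / n) ∈ A} → P B = 0) ∧
    (∀ B : Set (ℕ → Ω₁), MeasurableSet B →
        {ω : ℕ → Ω₁ | atTop.liminf (fun n : ℕ => (∑ i ∈ Finset.range n, Ψ (ω i)) / n) ∈ A} ⊆ B → P B = 1) := by
  obtain rfl : P = Measure.infinitePi (fun _ : ℕ => P₁) :=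
    hP.unique (Measure.isProjectiveLimit_infinitePi fun _ : ℕ => P₁)
  have key {c : ℝ} (hc : c ∈ Set.Icc (∫ x, Ψlow x ∂P₁) (∫ x, Ψup x ∂P₁)) {B : Set (ℕ → Ω₁)}
      (hB : MeasurableSet B) (hB' : Measure.infinitePi (fun _ : ℕ => P₁) B ≠ 0) :
      ∃ ω ∈ B, atTop.liminf (fun n : ℕ => (∑ i ∈ Finset.range n, Ψ (ω i)) / n) = c := by
    obtain ⟨ω, hω, h⟩ := exists_mem_tendsto_average hΨlow hΨup hΨabs hInt hc hB hB'
    exact ⟨ω, hω, h.liminf_eq⟩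
  refine ⟨fun B hB hsub => ?_, fun B hB hsub => ?_⟩
  · obtain ⟨c, hc, hcA⟩ := Set.exists_of_ssubset (hA₂.ssubset_of_ne hA₃)
    by_contra hne
    obtain ⟨ω, hω, h⟩ := key hc hB hne
    exact hcA (h ▸ hsub hω)
  · obtain ⟨c, hc⟩ := hA₁
    rw [← prob_compl_eq_zero_iff hB]
    by_contra hne
    obtain ⟨ω, hω, h⟩ := key (hA₂ hc) hB.compl hne
    exact hω (hsub (show _ ∈ A from h ▸ hc))
end

section
/- Let (Ω, F, P) be a probability space and let f : Ω → ℝ be a simple function (taking only finitely many values), possibly nonmeasurable. Let f_* be a maximal measurable minorant of f with respect to P. Then there exists a σ-algebra F' on Ω with F ⊆ F' and f F'-measurable, and a probability measure Q on (Ω, F') agreeing with P on F, such that f = f_* Q-almost surely. -/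
open MeasureTheory Filter Topology

/-- A measurable set on which a maximal measurable minorant of a simple function is strictly
smaller than the function is null. -/
lemma IsMeasMinorant.measure_eq_zero_of_lt {Ω : Type*} [MeasurableSpace Ω] {P : Measure Ω}
    {f flow : Ω → ℝ} (hflow : IsMeasMinorant P f flow) (hf : (Set.range f).Finite)
    {N : Set Ω} (hN : MeasurableSet N) (hlt : ∀ ω ∈ N, flow ω < f ω) : P N = 0 := by
  obtain ⟨hm, hle, hmax⟩ := hflow
  -- the part of `N` where `y` is the least value of `f` exceeding `flow`
  let M : ℝ → Set Ω := fun y ↦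
    N ∩ ({ω | flow ω < y} ∩ ⋂ z ∈ Set.range f, {ω | flow ω < z → y ≤ z})
  have hMmeas (y : ℝ) : MeasurableSet (M y) := by
    refine hN.inter ((measurableSet_lt hm measurable_const).inter
      (MeasurableSet.biInter hf.countable fun z _ ↦ ?_))
    by_cases h : y ≤ z
    · simp [h]
    · simpa [h] using measurableSet_le measurable_const hm
  have hMnull (y : ℝ) : P (M y) = 0 := by
    classical
    have hg := hmax ((M y).piecewise (fun _ ↦ y) flow)
      (Measurable.piecewise (hMmeas y) measurable_const hm) fun ω ↦ by
        by_cases h : ω ∈ M y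
        · simp only [Set.piecewise, h, if_true]
          exact Set.mem_iInter₂.1 h.2.2 (f ω) ⟨ω, rfl⟩ (hlt ω h.1)
        · simpa [Set.piecewise, h] using hle ω
    refine measure_mono_null (fun ω h ↦ ?_) (ae_iff.1 hg)
    simpa [Set.piecewise, h] using h.2.1
  refine measure_mono_null (t := ⋃ y ∈ Set.range f, M y) (fun ω hω ↦ ?_)
    ((measure_biUnion_null_iff hf.countable).2 fun y _ ↦ hMnull y)
  obtain ⟨y, ⟨hy, hωy⟩, hmin⟩ := Set.exists_min_image (Set.range f ∩ {z | flow ω < z}) id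
    (hf.subset Set.inter_subset_left) ⟨f ω, ⟨ω, rfl⟩, hlt ω hω⟩
  exact Set.mem_biUnion hy ⟨hω, hωy, Set.mem_iInter₂.2 fun z hz hωz ↦ hmin z ⟨hz, hωz⟩⟩

/-- The σ-algebra of all sets that agree on `A` with a measurable set. -/
@[reducible] def MeasurableSpace.traceExtension {Ω : Type*} (F : MeasurableSpace Ω) (A : Set Ω) :
    MeasurableSpace Ω :=
  (F.comap ((↑) : A → Ω)).map (↑)

lemma MeasurableSpace.measurableSet_traceExtension_iff {Ω : Type*} {F : MeasurableSpace Ω}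
    {A E : Set Ω} :
    MeasurableSet[F.traceExtension A] E ↔ ∃ G, MeasurableSet[F] G ∧ A ∩ G = A ∩ E := by
  change (∃ G, MeasurableSet[F] G ∧ ((↑) : A → Ω) ⁻¹' G = (↑) ⁻¹' E) ↔ _
  simp only [Subtype.preimage_coe_eq_preimage_coe_iff]

lemma MeasurableSpace.le_traceExtension {Ω : Type*} (F : MeasurableSpace Ω) (A : Set Ω) :
    F ≤ F.traceExtension A :=
  fun E hE ↦ measurableSet_traceExtension_iff.2 ⟨E, hE, rfl⟩

/-- A function agreeing on `A` with a measurable function is measurable for the trace extension. -/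
lemma Measurable.traceExtension_of_eqOn {Ω β : Type*} {F : MeasurableSpace Ω} [MeasurableSpace β]
    {A : Set Ω} {f g : Ω → β} (hg : Measurable g) (h : Set.EqOn f g A) :
    Measurable[F.traceExtension A] f := by
  refine fun s hs ↦ MeasurableSpace.measurableSet_traceExtension_iff.2 ⟨g ⁻¹' s, hg hs, ?_⟩
  ext ω
  simp only [Set.mem_inter_iff, Set.mem_preimage, and_congr_right_iff]
  intro hω
  rw [h hω]

lemma MeasureTheory.Measure.traceExtension_le_caratheodory {Ω : Type*} {F : MeasurableSpace Ω}
    (P : Measure Ω) (A : Set Ω) :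
    F.traceExtension A ≤ (OuterMeasure.restrict A P.toOuterMeasure).caratheodory := by
  intro E hE
  obtain ⟨G, hG, hGE⟩ := MeasurableSpace.measurableSet_traceExtension_iff.1 hE
  refine (OuterMeasure.isCaratheodory_iff _).2 fun T ↦ ?_
  simp only [OuterMeasure.restrict_apply, Measure.coe_toOuterMeasure]
  rw [← measure_inter_add_sdiff (T ∩ A) hG]
  have h (ω : Ω) (hω : ω ∈ A) : ω ∈ G ↔ ω ∈ E := by
    simpa [hω] using Set.ext_iff.1 hGE ω
  congr 2 <;> ext ω <;> simp only [Set.mem_inter_iff, Set.mem_sdiff] <;> grind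

/-- The measure `E ↦ P (E ∩ A)` (outer measure) on the trace extension. -/
noncomputable def MeasureTheory.Measure.traceExtension {Ω : Type*} {F : MeasurableSpace Ω}
    (P : Measure Ω) (A : Set Ω) : @Measure Ω (F.traceExtension A) :=
  @OuterMeasure.toMeasure Ω (F.traceExtension A) (OuterMeasure.restrict A P.toOuterMeasure)
    (P.traceExtension_le_caratheodory A)

lemma MeasureTheory.Measure.traceExtension_apply {Ω : Type*} {F : MeasurableSpace Ω}
    (P : Measure Ω) {A E : Set Ω} (hE : MeasurableSet[F.traceExtension A] E) :
    P.traceExtension A E = P (E ∩ A) := by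
  rw [Measure.traceExtension, @toMeasure_apply Ω (F.traceExtension A) _ _ _ hE]
  simp

/-- **Extension making a simple function equal to its maximal measurable minorant.**
If `f` is a simple (finitely-valued, possibly nonmeasurable) function on a probability
space `(Ω, F, P)` and `flow` is a maximal measurable minorant of `f`, then there is an
extension `Q` of `P` to a σ-algebra `F' ⊇ F` making `f` measurable such that `f = flow`
`Q`-almost surely. -/
theorem exists_extension_simple_eq_minorant
    {Ω : Type*} [F : MeasurableSpace Ω] (P : Measure Ω) [IsProbabilityMeasure P]
    (f flow : Ω → ℝ) (hf : (Set.range f).Finite)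
    (hflow : IsMeasMinorant P f flow) :
    ∃ F' : MeasurableSpace Ω, F ≤ F' ∧ Measurable[F'] f ∧
      ∃ Q : @Measure Ω F', IsProbabilityMeasure Q ∧
        (∀ E : Set Ω, MeasurableSet[F] E → Q E = P E) ∧
        ∀ᵐ ω ∂Q, f ω = flow ω := by
  let A : Set Ω := {ω | f ω = flow ω}
  have hA : P (toMeasurable P A)ᶜ = 0 :=
    hflow.measure_eq_zero_of_lt hf (measurableSet_toMeasurable P A).compl fun ω hω ↦
      (hflow.2.1 ω).lt_of_ne' fun h ↦ hω (subset_toMeasurable P A h)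
  have hQ (E : Set Ω) (hE : MeasurableSet[F] E) : P.traceExtension A E = P E := by
    rw [P.traceExtension_apply (F.le_traceExtension A E hE), Set.inter_comm,
      ← Measure.measure_toMeasurable_inter hE (measure_ne_top P A), Set.inter_comm]
    exact measure_inter_conull hA
  have hAmeas : MeasurableSet[F.traceExtension A] Aᶜ :=
    MeasurableSpace.measurableSet_traceExtension_iff.2 ⟨∅, MeasurableSet.empty, by simp⟩
  refine ⟨F.traceExtension A, F.le_traceExtension A,
    hflow.1.traceExtension_of_eqOn fun ω hω ↦ hω, P.traceExtension A, ?_, hQ, ?_⟩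
  · exact @IsProbabilityMeasure.mk Ω (F.traceExtension A) _
      ((hQ Set.univ MeasurableSet.univ).trans measure_univ)
  · change P.traceExtension A Aᶜ = 0
    rw [P.traceExtension_apply hAmeas]
    simp
end
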